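/- For each n ≥ 2 let O^{(n)} be Haar distributed on the orthogonal group O(n) and set T^{(n)}_{p,q} = Σ_{i≤p, j≤q} (O^{(n)}_{ij})². Fix s, t ∈ [0,1]. Then the real random variables T^{(n)}_{⌊ns⌋,⌊nt⌋} − E[T^{(n)}_{⌊ns⌋,⌊nt⌋}] converge in distribution, as n → ∞, to a centered Gaussian random variable with variance 2 s(1−s)t(1−t). -/

import Mathlib

open MeasureTheory Matrix Filter ProbabilityTheory

/-- The entrywise (Borel) measurable structure on matrices. -/
instance matrixMeasurableSpace {m n α : Type*} [MeasurableSpace α] :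
    MeasurableSpace (Matrix m n α) :=
  inferInstanceAs (MeasurableSpace (m → n → α))

/-- `T_{p,q} = Σ_{1 ≤ i ≤ p, 1 ≤ j ≤ q} O_{ij}²`. -/
noncomputable def truncTraceO (n p q : ℕ) (O : Matrix.orthogonalGroup (Fin n) ℝ) : ℝ :=
  ∑ i : Fin n, ∑ j : Fin n,
    if (i : ℕ) < p ∧ (j : ℕ) < q then ((O : Matrix (Fin n) (Fin n) ℝ) i j) ^ 2 else 0

namespace TruncCLT

/-- The orthogonal group. -/
abbrev OG (n : ℕ) := Matrix.orthogonalGroup (Fin n) ℝ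

instance instBorelMat (n : ℕ) : BorelSpace (Matrix (Fin n) (Fin n) ℝ) :=
  inferInstanceAs (BorelSpace (Fin n → Fin n → ℝ))

lemma row_orth {n : ℕ} (O : OG n) (a b : Fin n) :
    ∑ l, O.1 a l * O.1 b l = if a = b then 1 else 0 := by
  have h := (Matrix.mem_orthogonalGroup_iff (Fin n) ℝ).1 O.2
  have h2 := congrFun (congrFun h a) b
  simpa [Matrix.mul_apply, Matrix.one_apply] using h2

lemma col_orth {n : ℕ} (O : OG n) (a b : Fin n) :
    ∑ l, O.1 l a * O.1 l b = if a = b then 1 else 0 := by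
  have h := (Matrix.mem_orthogonalGroup_iff' (Fin n) ℝ).1 O.2
  have h2 := congrFun (congrFun h a) b
  simpa [Matrix.mul_apply, Matrix.one_apply] using h2

lemma entry_bound {n : ℕ} (O : OG n) (a b : Fin n) : |O.1 a b| ≤ 1 := by
  have h := row_orth O a a
  rw [if_pos rfl] at h
  have h1 : O.1 a b * O.1 a b ≤ ∑ l, O.1 a l * O.1 a l :=
    Finset.single_le_sum (f := fun l => O.1 a l * O.1 a l)
      (fun l _ => mul_self_nonneg _) (Finset.mem_univ b)
  rw [abs_le]
  constructor <;> nlinarith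

lemma continuous_entry {n : ℕ} (a b : Fin n) : Continuous (fun O : OG n => O.1 a b) :=
  (continuous_subtype_val).matrix_elem a b

instance instCompactOG (n : ℕ) : CompactSpace (OG n) := by
  refine isCompact_iff_compactSpace.1 (?_ : IsCompact ((Matrix.orthogonalGroup (Fin n) ℝ :
    Submonoid (Matrix (Fin n) (Fin n) ℝ)) : Set (Matrix (Fin n) (Fin n) ℝ)))
  have hK : IsCompact (Set.pi Set.univ
      (fun _ : Fin n => Set.pi Set.univ (fun _ : Fin n => Set.Icc (-1 : ℝ) 1))) :=
    isCompact_univ_pi fun _ => isCompact_univ_pi fun _ => isCompact_Icc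
  refine IsCompact.of_isClosed_subset (X := Matrix (Fin n) (Fin n) ℝ) hK ?_ ?_
  · have : ((Matrix.orthogonalGroup (Fin n) ℝ : Submonoid (Matrix (Fin n) (Fin n) ℝ)) :
        Set (Matrix (Fin n) (Fin n) ℝ)) = {A | A * Aᵀ = 1} := by
      ext A
      exact Matrix.mem_orthogonalGroup_iff (Fin n) ℝ
    change IsClosed ((Matrix.orthogonalGroup (Fin n) ℝ : Submonoid (Matrix (Fin n) (Fin n) ℝ)) :
        Set (Matrix (Fin n) (Fin n) ℝ))
    rw [this]
    exact isClosed_eq (by fun_prop) continuous_const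
  · intro A hA
    intro i _ j _
    have := entry_bound (⟨A, hA⟩ : OG n) i j
    exact abs_le.1 this

lemma integrable_cont {n : ℕ} {E : Type*} [NormedAddCommGroup E] [SecondCountableTopology E]
    (μ : Measure (OG n)) [IsFiniteMeasure μ]
    {f : OG n → E} (hf : Continuous f) : Integrable f μ := by
  borelize E
  obtain ⟨C, hC⟩ := isCompact_univ.exists_bound_of_continuousOn hf.continuousOn
  exact Integrable.of_bound hf.aestronglyMeasurable C
    (Eventually.of_forall fun x => hC x (Set.mem_univ x))

/-- The rotation matrix. -/
noncomputable def rotM {n : ℕ} (i j : Fin n) (θ : ℝ) : Matrix (Fin n) (Fin n) ℝ :=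
  fun a b => if a = i then (if b = i then Real.cos θ else if b = j then Real.sin θ else 0)
    else if a = j then (if b = j then Real.cos θ else if b = i then - Real.sin θ else 0)
    else if a = b then 1 else 0

lemma rotM_mul {n : ℕ} {i j : Fin n} (hij : i ≠ j) (θ : ℝ) (B : Matrix (Fin n) (Fin n) ℝ)
    (a b : Fin n) : (rotM i j θ * B) a b =
      if a = i then Real.cos θ * B i b + Real.sin θ * B j b
      else if a = j then Real.cos θ * B j b - Real.sin θ * B i b else B a b := by
  rw [Matrix.mul_apply]
  unfold rotM
  by_cases ha : a = i
  · subst ha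
    have : ∀ x, (if x = a then Real.cos θ else if x = j then Real.sin θ else 0) * B x b =
      (if x = a then Real.cos θ * B x b else 0) + (if x = j then Real.sin θ * B x b else 0) := by
      intro x
      by_cases h1 : x = a
      · subst h1; simp [hij]
      · by_cases h2 : x = j
        · subst h2; simp [h1]
        · simp [h1, h2]
    simp [this, Finset.sum_add_distrib]
  · by_cases hb : a = j
    · subst hb
      have : ∀ x, (if x = a then Real.cos θ else if x = i then -Real.sin θ else 0) * B x b =
        (if x = a then Real.cos θ * B x b else 0) - (if x = i then Real.sin θ * B x b else 0) := by
        intro x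
        by_cases h1 : x = a
        · subst h1; simp [ha]
        · by_cases h2 : x = i
          · subst h2; simp [h1]
          · simp [h1, h2]
      simp [this, Finset.sum_sub_distrib, ha]
    · simp [ha, hb]

lemma rotM_mem {n : ℕ} {i j : Fin n} (hij : i ≠ j) (θ : ℝ) :
    rotM i j θ ∈ Matrix.orthogonalGroup (Fin n) ℝ := by
  rw [Matrix.mem_orthogonalGroup_iff]
  ext a b
  rw [rotM_mul hij]
  have h := Real.sin_sq_add_cos_sq θ
  have hji := hij.symm
  simp only [Matrix.transpose_apply, rotM, Matrix.one_apply]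
  by_cases h1 : a = i
  · subst h1
    by_cases h2 : b = a
    · subst h2; simp [hij, hji]; linarith
    · by_cases h3 : b = j
      · subst h3; simp [hij, hji]; ring
      · simp [h2, h3, Ne.symm h2]
  · by_cases h1' : a = j
    · subst h1'
      by_cases h2 : b = i
      · subst h2; simp [hij, hji]; ring
      · by_cases h3 : b = a
        · subst h3; simp [hij, hji]; linarith
        · simp [h1, h2, h3, Ne.symm h3]
    · by_cases h2 : b = i
      · subst h2; simp [h1, h1']
      · by_cases h3 : b = j
        · subst h3; simp [h1, h1', h2]
        · simp [h1, h1', h2, h3, eq_comm]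

/-- The rotation as a group element. -/
noncomputable def rot {n : ℕ} {i j : Fin n} (hij : i ≠ j) (θ : ℝ) : OG n :=
  ⟨rotM i j θ, rotM_mem hij θ⟩

lemma rot_mul_apply {n : ℕ} {i j : Fin n} (hij : i ≠ j) (θ : ℝ) (O : OG n) (a b : Fin n) :
    (rot hij θ * O).1 a b =
      if a = i then Real.cos θ * O.1 i b + Real.sin θ * O.1 j b
      else if a = j then Real.cos θ * O.1 j b - Real.sin θ * O.1 i b else O.1 a b :=
  rotM_mul hij θ O.1 a b

lemma rot_add {n : ℕ} {i j : Fin n} (hij : i ≠ j) (θ η : ℝ) (O : OG n) :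
    rot hij (η + θ) * O = rot hij η * (rot hij θ * O) := by
  apply Subtype.ext
  ext a b
  simp only [rot_mul_apply, Real.cos_add, Real.sin_add]
  have hji := hij.symm
  by_cases h1 : a = i
  · subst h1; simp [hji]; ring
  · by_cases h2 : a = j
    · subst h2; simp [hji]; ring
    · simp [h1, h2]

lemma rot_zero {n : ℕ} {i j : Fin n} (hij : i ≠ j) (O : OG n) : rot hij 0 * O = O := by
  apply Subtype.ext
  ext a b
  simp only [rot_mul_apply, Real.cos_zero, Real.sin_zero]
  by_cases h1 : a = i
  · subst h1; simp
  · by_cases h2 : a = j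
    · subst h2; simp [h1]
    · simp [h1, h2]

lemma integral_deriv_zero {n : ℕ} {i j : Fin n} (hij : i ≠ j)
    (μ : Measure (OG n)) [μ.IsHaarMeasure] [IsProbabilityMeasure μ]
    {F DF : OG n → ℂ} (hF : Continuous F) (hDF : Continuous DF)
    (hd : ∀ O, HasDerivAt (fun θ => F (rot hij θ * O)) (DF O) 0) :
    ∫ O, DF O ∂μ = 0 := by
  obtain ⟨C, hC⟩ := isCompact_univ.exists_bound_of_continuousOn hDF.continuousOn
  have hd' : ∀ O θ, HasDerivAt (fun θ => F (rot hij θ * O)) (DF (rot hij θ * O)) θ := by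
    intro O θ
    have h := hd (rot hij θ * O)
    have h0 : (0 : ℝ) = θ + -θ := by ring
    rw [h0] at h
    have h2 := HasDerivAt.comp_add_const θ (-θ) h
    refine h2.congr_of_eventuallyEq (Eventually.of_forall fun x => ?_)
    simp only
    rw [← rot_add]
    congr 3
    ring
  have key := hasDerivAt_integral_of_dominated_loc_of_deriv_le (μ := μ)
    (F := fun θ O => F (rot hij θ * O)) (F' := fun θ O => DF (rot hij θ * O)) (x₀ := (0 : ℝ))
    (s := Set.univ) (bound := fun _ => C) Filter.univ_mem
    (Eventually.of_forall fun θ =>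
      (hF.comp (continuous_const.mul continuous_id)).aestronglyMeasurable)
    (integrable_cont μ (hF.comp (continuous_const.mul continuous_id)))
    (hDF.comp (continuous_const.mul continuous_id)).aestronglyMeasurable
    (Eventually.of_forall fun O θ _ => hC _ (Set.mem_univ _))
    (integrable_const _)
    (Eventually.of_forall fun O θ _ => hd' O θ)
  have k2 := key.2
  have hinv : ∀ (H : OG n → ℂ) (θ : ℝ), ∫ O, H (rot hij θ * O) ∂μ = ∫ O, H O ∂μ :=
    fun H θ => integral_mul_left_eq_self H (rot hij θ)
  simp only [hinv] at k2
  exact k2.unique (hasDerivAt_const _ _)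

/-- The projection matrix `M = O Q Oᵀ`. -/
noncomputable def MM {n : ℕ} (Q : Finset (Fin n)) (O : OG n) (a b : Fin n) : ℝ :=
  ∑ l ∈ Q, O.1 a l * O.1 b l

lemma MM_cont {n : ℕ} (Q : Finset (Fin n)) (a b : Fin n) : Continuous (fun O => MM Q O a b) := by
  unfold MM
  exact continuous_finsetSum _ fun l _ => (continuous_entry a l).mul (continuous_entry b l)

lemma MM_symm {n : ℕ} (Q : Finset (Fin n)) (O : OG n) (a b : Fin n) : MM Q O a b = MM Q O b a := by
  unfold MM
  exact Finset.sum_congr rfl fun l _ => mul_comm _ _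

lemma MM_proj {n : ℕ} (Q : Finset (Fin n)) (O : OG n) (a c : Fin n) :
    ∑ b, MM Q O a b * MM Q O b c = MM Q O a c := by
  unfold MM
  simp only [Finset.sum_mul_sum]
  rw [Finset.sum_comm]
  refine Finset.sum_congr rfl fun l hl => ?_
  rw [Finset.sum_comm]
  have : ∀ m ∈ Q, ∑ b, O.1 a l * O.1 b l * (O.1 b m * O.1 c m) =
      if l = m then O.1 a l * O.1 c m else 0 := by
    intro m _
    have h := col_orth O l m
    calc ∑ b, O.1 a l * O.1 b l * (O.1 b m * O.1 c m)
        = O.1 a l * O.1 c m * ∑ b, O.1 b l * O.1 b m := by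
          rw [Finset.mul_sum]; exact Finset.sum_congr rfl fun b _ => by ring
      _ = _ := by rw [h]; split_ifs <;> ring
  rw [Finset.sum_congr rfl this, Finset.sum_ite_eq]
  simp [hl]

lemma MM_trace {n : ℕ} (Q : Finset (Fin n)) (O : OG n) : ∑ a, MM Q O a a = Q.card := by
  unfold MM
  rw [Finset.sum_comm]
  have : ∀ l ∈ Q, ∑ a, O.1 a l * O.1 a l = 1 := fun l _ => by
    rw [col_orth]; simp
  rw [Finset.sum_congr rfl this]
  simp

lemma MM_sq {n : ℕ} (Q : Finset (Fin n)) (O : OG n) (a : Fin n) :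
    ∑ b, MM Q O a b ^ 2 = MM Q O a a := by
  rw [← MM_proj Q O a a]
  exact Finset.sum_congr rfl fun b _ => by rw [MM_symm Q O b a]; ring

lemma MM_diag_nonneg {n : ℕ} (Q : Finset (Fin n)) (O : OG n) (a : Fin n) : 0 ≤ MM Q O a a := by
  rw [← MM_sq]; positivity

lemma MM_diag_le {n : ℕ} (Q : Finset (Fin n)) (O : OG n) (a : Fin n) : MM Q O a a ≤ 1 := by
  have h := MM_sq Q O a
  have h1 : MM Q O a a ^ 2 ≤ ∑ b, MM Q O a b ^ 2 :=
    Finset.single_le_sum (f := fun b => MM Q O a b ^ 2)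
      (fun l _ => sq_nonneg _) (Finset.mem_univ a)
  nlinarith

lemma MM_deriv {n : ℕ} (Q : Finset (Fin n)) {i j : Fin n} (hij : i ≠ j) (O : OG n) (a b : Fin n) :
    HasDerivAt (fun θ => MM Q (rot hij θ * O) a b)
      ((if a = i then MM Q O j b else 0) - (if a = j then MM Q O i b else 0)
        + (if b = i then MM Q O a j else 0) - (if b = j then MM Q O a i else 0)) 0 := by
  have he : ∀ a l, HasDerivAt (fun θ => (rot hij θ * O).1 a l)
      ((if a = i then O.1 j l else 0) - (if a = j then O.1 i l else 0)) 0 := by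
    intro a l
    simp only [rot_mul_apply]
    have hc : HasDerivAt Real.cos 0 0 := by simpa using Real.hasDerivAt_cos 0
    have hs : HasDerivAt Real.sin 1 0 := by simpa using Real.hasDerivAt_sin 0
    by_cases h1 : a = i
    · subst h1
      simp only [hij, if_true, if_false]
      exact ((hc.mul_const (O.1 a l)).fun_add (hs.mul_const (O.1 j l))).congr_deriv (by ring)
    · by_cases h2 : a = j
      · subst h2
        simp only [h1, if_true, if_false]
        exact ((hc.mul_const (O.1 a l)).fun_sub (hs.mul_const (O.1 i l))).congr_deriv (by ring)
      · simpa [h1, h2] using hasDerivAt_const (0 : ℝ) (O.1 a l)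
  unfold MM
  have := HasDerivAt.fun_sum (u := Q) (fun l _ => (he a l).fun_mul (he b l))
  simp only [rot_zero] at this
  refine this.congr_deriv ?_
  rw [Finset.sum_add_distrib]
  simp only [sub_mul, mul_sub, Finset.sum_sub_distrib, ite_mul, mul_ite, zero_mul, mul_zero]
  split_ifs <;> (try simp only [Finset.sum_const_zero]) <;> ring

end TruncCLT
namespace TruncCLT

/-- The truncated trace. -/
noncomputable def TT {n : ℕ} (P Q : Finset (Fin n)) (O : OG n) : ℝ := ∑ k ∈ P, MM Q O k k

/-- The squared norm of the off-diagonal block. -/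
noncomputable def GG {n : ℕ} (P Q : Finset (Fin n)) (O : OG n) : ℝ :=
  ∑ i ∈ P, ∑ j ∈ Pᶜ, MM Q O i j ^ 2

/-- The cubic remainder. -/
noncomputable def VV {n : ℕ} (P Q : Finset (Fin n)) (O : OG n) : ℝ :=
  ∑ i ∈ P, ∑ j ∈ Pᶜ, ∑ k ∈ P, MM Q O i k * MM Q O k j * MM Q O i j

lemma TT_cont {n : ℕ} (P Q : Finset (Fin n)) : Continuous (TT P Q) :=
  continuous_finsetSum _ fun _ _ => MM_cont Q _ _

lemma GG_cont {n : ℕ} (P Q : Finset (Fin n)) : Continuous (GG P Q) :=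
  continuous_finsetSum _ fun _ _ => continuous_finsetSum _ fun _ _ => (MM_cont Q _ _).pow 2

lemma VV_cont {n : ℕ} (P Q : Finset (Fin n)) : Continuous (VV P Q) :=
  continuous_finsetSum _ fun _ _ => continuous_finsetSum _ fun _ _ =>
    continuous_finsetSum _ fun _ _ => ((MM_cont Q _ _).mul (MM_cont Q _ _)).mul (MM_cont Q _ _)

lemma TT_deriv {n : ℕ} (P Q : Finset (Fin n)) {i j : Fin n} (hij : i ≠ j) (hi : i ∈ P) (hj : j ∉ P)
    (O : OG n) : HasDerivAt (fun θ => TT P Q (rot hij θ * O)) (2 * MM Q O i j) 0 := by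
  unfold TT
  refine (HasDerivAt.fun_sum (u := P) (fun k _ => MM_deriv Q hij O k k)).congr_deriv ?_
  rw [Finset.sum_sub_distrib, Finset.sum_add_distrib, Finset.sum_sub_distrib]
  simp only [Finset.sum_ite_eq', hi, hj, if_true, if_false]
  rw [MM_symm Q O j i]
  ring

lemma ibp {n : ℕ} (P Q : Finset (Fin n)) {i j : Fin n} (hij : i ≠ j) (hi : i ∈ P) (hj : j ∉ P)
    (μ : Measure (OG n)) [μ.IsHaarMeasure] [IsProbabilityMeasure μ]
    {h Dh : OG n → ℝ} (hh : Continuous h) (hDh : Continuous Dh)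
    (hd : ∀ O, HasDerivAt (fun θ => h (rot hij θ * O)) (Dh O) 0)
    {φ φ' : ℝ → ℂ} (hφ : ∀ x, HasDerivAt φ (φ' x) x) (hφ' : Continuous φ') :
    ∫ O, ((Dh O : ℂ) * φ (TT P Q O) + ((2 * (h O * MM Q O i j) : ℝ) : ℂ) * φ' (TT P Q O)) ∂μ
      = 0 := by
  have hφc : Continuous φ := continuous_iff_continuousAt.2 fun x => (hφ x).continuousAt
  have cT := TT_cont P Q
  have cM := MM_cont Q i j
  refine integral_deriv_zero hij μ (F := fun O => (h O : ℂ) * φ (TT P Q O)) ?_ ?_ ?_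
  · exact (Complex.continuous_ofReal.comp hh).mul (hφc.comp cT)
  · exact ((Complex.continuous_ofReal.comp hDh).mul (hφc.comp cT)).add
      ((Complex.continuous_ofReal.comp (continuous_const.mul (hh.mul cM))).mul (hφ'.comp cT))
  · intro O
    have h1 := (hd O).ofReal_comp
    have h2 := TT_deriv P Q hij hi hj O
    have h3 : HasDerivAt (fun θ => φ (TT P Q (rot hij θ * O)))
        ((2 * MM Q O i j : ℝ) • φ' (TT P Q O)) 0 := by
      have h0 : φ' (TT P Q O) = φ' (TT P Q (rot hij 0 * O)) := by rw [rot_zero]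
      rw [h0]
      exact HasDerivAt.scomp (0 : ℝ) (hφ (TT P Q (rot hij 0 * O))) h2
    refine (h1.fun_mul h3).congr_deriv ?_
    simp only [rot_zero, Complex.real_smul]
    push_cast
    ring

lemma sum_compl_diag {n : ℕ} (P Q : Finset (Fin n)) (O : OG n) :
    ∑ j ∈ Pᶜ, MM Q O j j = Q.card - TT P Q O := by
  have h := Finset.sum_add_sum_compl P (fun j => MM Q O j j)
  rw [MM_trace] at h
  unfold TT
  linarith

lemma card_compl_real {n : ℕ} (P : Finset (Fin n)) : ((Pᶜ.card : ℕ) : ℝ) = n - P.card := by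
  have h := Finset.card_add_card_compl P
  rw [Fintype.card_fin] at h
  have : (P.card : ℝ) + Pᶜ.card = n := by exact_mod_cast h
  linarith

lemma ne_of_P {n : ℕ} {P : Finset (Fin n)} {i j : Fin n} (hi : i ∈ P) (hj : j ∈ Pᶜ) : i ≠ j := by
  rintro rfl
  exact (Finset.mem_compl.1 hj) hi

lemma ident1 {n : ℕ} (P Q : Finset (Fin n))
    (μ : Measure (OG n)) [μ.IsHaarMeasure] [IsProbabilityMeasure μ]
    {φ φ' : ℝ → ℂ} (hφ : ∀ x, HasDerivAt φ (φ' x) x) (hφ' : Continuous φ') :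
    ∫ O, (((P.card * Q.card - n * TT P Q O : ℝ) : ℂ) * φ (TT P Q O)
      + ((2 * GG P Q O : ℝ) : ℂ) * φ' (TT P Q O)) ∂μ = 0 := by
  have hφc : Continuous φ := continuous_iff_continuousAt.2 fun x => (hφ x).continuousAt
  have cT := TT_cont P Q
  have key : ∀ i ∈ P, ∀ j ∈ Pᶜ,
      ∫ O, (((MM Q O j j - MM Q O i i : ℝ) : ℂ) * φ (TT P Q O)
        + ((2 * (MM Q O i j * MM Q O i j) : ℝ) : ℂ) * φ' (TT P Q O)) ∂μ = 0 := by
    intro i hi j hj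
    have hij := ne_of_P hi hj
    refine ibp P Q hij hi (Finset.mem_compl.1 hj) μ (h := fun O => MM Q O i j)
      (Dh := fun O => MM Q O j j - MM Q O i i) (MM_cont Q i j)
      ((MM_cont Q j j).sub (MM_cont Q i i)) ?_ hφ hφ'
    intro O
    refine (MM_deriv Q hij O i j).congr_deriv ?_
    simp [hij, hij.symm]
  have hint : ∀ i j, Integrable (fun O => (((MM Q O j j - MM Q O i i : ℝ) : ℂ) * φ (TT P Q O)
        + ((2 * (MM Q O i j * MM Q O i j) : ℝ) : ℂ) * φ' (TT P Q O))) μ := by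
    intro i j
    apply integrable_cont
    exact ((Complex.continuous_ofReal.comp ((MM_cont Q j j).sub (MM_cont Q i i))).mul
      (hφc.comp cT)).add ((Complex.continuous_ofReal.comp (continuous_const.mul
        ((MM_cont Q i j).mul (MM_cont Q i j)))).mul (hφ'.comp cT))
  have hsum : ∫ O, ∑ i ∈ P, ∑ j ∈ Pᶜ, (((MM Q O j j - MM Q O i i : ℝ) : ℂ) * φ (TT P Q O)
        + ((2 * (MM Q O i j * MM Q O i j) : ℝ) : ℂ) * φ' (TT P Q O)) ∂μ = 0 := by
    rw [integral_finsetSum _ fun i _ => integrable_finsetSum _ fun j _ => hint i j]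
    refine Finset.sum_eq_zero fun i hi => ?_
    rw [integral_finsetSum _ fun j _ => hint i j]
    exact Finset.sum_eq_zero fun j hj => key i hi j hj
  rw [← hsum]
  congr 1
  ext O
  simp only [Finset.sum_add_distrib, ← Finset.sum_mul, ← Complex.ofReal_sum]
  have e1 : ∑ i ∈ P, ∑ j ∈ Pᶜ, (MM Q O j j - MM Q O i i) = P.card * Q.card - n * TT P Q O := by
    simp only [Finset.sum_sub_distrib, sum_compl_diag, Finset.sum_const, nsmul_eq_mul,
      card_compl_real, ← Finset.mul_sum]
    rw [← TT]
    ring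
  have e2 : ∑ i ∈ P, ∑ j ∈ Pᶜ, 2 * (MM Q O i j * MM Q O i j) = 2 * GG P Q O := by
    unfold GG
    simp only [Finset.mul_sum, sq]
  rw [e1, e2]

lemma GG_add {n : ℕ} (P Q : Finset (Fin n)) (O : OG n) :
    ∑ i ∈ P, ∑ k ∈ P, MM Q O i k ^ 2 = TT P Q O - GG P Q O := by
  unfold TT GG
  rw [← Finset.sum_sub_distrib]
  refine Finset.sum_congr rfl fun i _ => ?_
  rw [← MM_sq, ← Finset.sum_add_sum_compl P (fun b => MM Q O i b ^ 2)]
  ring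

lemma ident2 {n : ℕ} (P Q : Finset (Fin n))
    (μ : Measure (OG n)) [μ.IsHaarMeasure] [IsProbabilityMeasure μ]
    {φ φ' : ℝ → ℂ} (hφ : ∀ x, HasDerivAt φ (φ' x) x) (hφ' : Continuous φ') :
    ∫ O, ((((n + 1) * GG P Q O - (n - P.card) * TT P Q O
          + TT P Q O * (Q.card - TT P Q O) : ℝ) : ℂ) * φ (TT P Q O)
      + ((2 * VV P Q O : ℝ) : ℂ) * φ' (TT P Q O)) ∂μ = 0 := by
  have hφc : Continuous φ := continuous_iff_continuousAt.2 fun x => (hφ x).continuousAt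
  have cT := TT_cont P Q
  have cD : ∀ i j k, Continuous (fun O => (MM Q O j k + (if k = i then MM Q O i j else 0))
      * MM Q O k j + MM Q O i k * ((if k = i then MM Q O j j else 0) - MM Q O k i)) := by
    intro i j k
    have := MM_cont Q (n := n)
    split_ifs
    · exact (((this _ _).add (this _ _)).mul (this _ _)).add
        ((this _ _).mul ((this _ _).sub (this _ _)))
    · exact (((this _ _).add continuous_const).mul (this _ _)).add
        ((this _ _).mul (continuous_const.sub (this _ _)))
  have key : ∀ i ∈ P, ∀ j ∈ Pᶜ, ∀ k ∈ P,
      ∫ O, ((((MM Q O j k + (if k = i then MM Q O i j else 0)) * MM Q O k j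
        + MM Q O i k * ((if k = i then MM Q O j j else 0) - MM Q O k i) : ℝ) : ℂ) * φ (TT P Q O)
        + ((2 * (MM Q O i k * MM Q O k j * MM Q O i j) : ℝ) : ℂ) * φ' (TT P Q O)) ∂μ = 0 := by
    intro i hi j hj k hk
    have hij := ne_of_P hi hj
    have hkj := ne_of_P hk hj
    refine ibp P Q hij hi (Finset.mem_compl.1 hj) μ (h := fun O => MM Q O i k * MM Q O k j)
      ((MM_cont Q i k).mul (MM_cont Q k j)) (cD i j k) ?_ hφ hφ'
    intro O
    refine ((MM_deriv Q hij O i k).fun_mul (MM_deriv Q hij O k j)).congr_deriv ?_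
    simp [hij, hij.symm, hkj, rot_zero]
  have hint : ∀ i j k, Integrable (fun O => ((((MM Q O j k + (if k = i then MM Q O i j else 0))
        * MM Q O k j
        + MM Q O i k * ((if k = i then MM Q O j j else 0) - MM Q O k i) : ℝ) : ℂ) * φ (TT P Q O)
        + ((2 * (MM Q O i k * MM Q O k j * MM Q O i j) : ℝ) : ℂ) * φ' (TT P Q O))) μ := by
    intro i j k
    apply integrable_cont
    exact ((Complex.continuous_ofReal.comp (cD i j k)).mul
      (hφc.comp cT)).add ((Complex.continuous_ofReal.comp (continuous_const.mul
        (((MM_cont Q _ _).mul (MM_cont Q _ _)).mul (MM_cont Q i j)))).mul (hφ'.comp cT))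
  have hsum : ∫ O, ∑ i ∈ P, ∑ j ∈ Pᶜ, ∑ k ∈ P,
        ((((MM Q O j k + (if k = i then MM Q O i j else 0)) * MM Q O k j
        + MM Q O i k * ((if k = i then MM Q O j j else 0) - MM Q O k i) : ℝ) : ℂ) * φ (TT P Q O)
        + ((2 * (MM Q O i k * MM Q O k j * MM Q O i j) : ℝ) : ℂ) * φ' (TT P Q O)) ∂μ = 0 := by
    rw [integral_finsetSum _ fun i _ => integrable_finsetSum _ fun j _ =>
      integrable_finsetSum _ fun k _ => hint i j k]
    refine Finset.sum_eq_zero fun i hi => ?_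
    rw [integral_finsetSum _ fun j _ => integrable_finsetSum _ fun k _ => hint i j k]
    refine Finset.sum_eq_zero fun j hj => ?_
    rw [integral_finsetSum _ fun k _ => hint i j k]
    exact Finset.sum_eq_zero fun k hk => key i hi j hj k hk
  rw [← hsum]
  congr 1
  ext O
  simp only [Finset.sum_add_distrib, ← Finset.sum_mul, ← Complex.ofReal_sum]
  have e1 : ∑ i ∈ P, ∑ j ∈ Pᶜ, ∑ k ∈ P, ((MM Q O j k + (if k = i then MM Q O i j else 0))
        * MM Q O k j + MM Q O i k * ((if k = i then MM Q O j j else 0) - MM Q O k i))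
      = (n + 1) * GG P Q O - (n - P.card) * TT P Q O + TT P Q O * (Q.card - TT P Q O) := by
    have s1 : ∀ i ∈ P, ∀ j ∈ Pᶜ,
        ∑ k ∈ P, ((MM Q O j k + (if k = i then MM Q O i j else 0))
        * MM Q O k j + MM Q O i k * ((if k = i then MM Q O j j else 0) - MM Q O k i))
        = ∑ k ∈ P, MM Q O k j ^ 2 + MM Q O i j ^ 2 + MM Q O i i * MM Q O j j
          - ∑ k ∈ P, MM Q O i k ^ 2 := by
      intro i hi j hj
      have t : ∀ k, ((MM Q O j k + (if k = i then MM Q O i j else 0))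
        * MM Q O k j + MM Q O i k * ((if k = i then MM Q O j j else 0) - MM Q O k i))
        = MM Q O k j ^ 2 + (if k = i then MM Q O i j ^ 2 else 0)
          + (if k = i then MM Q O i i * MM Q O j j else 0) - MM Q O i k ^ 2 := by
        intro k
        rw [MM_symm Q O j k, MM_symm Q O k i]
        split_ifs with h
        · subst h; ring
        · ring
      simp only [t]
      rw [Finset.sum_sub_distrib, Finset.sum_add_distrib, Finset.sum_add_distrib]
      simp [hi]
    rw [Finset.sum_congr rfl fun i hi => Finset.sum_congr rfl fun j hj => s1 i hi j hj]
    simp only [Finset.sum_sub_distrib, Finset.sum_add_distrib, ← Finset.mul_sum, ← Finset.sum_mul,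
      sum_compl_diag, Finset.sum_const, nsmul_eq_mul, card_compl_real]
    have hc : ∑ j ∈ Pᶜ, ∑ k ∈ P, MM Q O k j ^ 2 = GG P Q O := by
      rw [Finset.sum_comm]; rfl
    rw [hc, GG_add]
    have hG : ∑ i ∈ P, ∑ j ∈ Pᶜ, MM Q O i j ^ 2 = GG P Q O := rfl
    have hT : ∑ i ∈ P, MM Q O i i = TT P Q O := rfl
    rw [hG, hT]
    ring
  have e2 : ∑ i ∈ P, ∑ j ∈ Pᶜ, ∑ k ∈ P, 2 * (MM Q O i k * MM Q O k j * MM Q O i j)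
      = 2 * VV P Q O := by
    unfold VV
    simp only [Finset.mul_sum]
  simp only [Finset.sum_add_distrib] at e1
  rw [e1, e2]

/-! Pointwise bounds. -/

lemma TT_nonneg {n : ℕ} (P Q : Finset (Fin n)) (O : OG n) : 0 ≤ TT P Q O :=
  Finset.sum_nonneg fun k _ => MM_diag_nonneg Q O k

lemma card_le_real {n : ℕ} (P : Finset (Fin n)) : (P.card : ℝ) ≤ n := by
  have := Finset.card_le_univ P
  rw [Fintype.card_fin] at this
  exact_mod_cast this

lemma TT_le {n : ℕ} (P Q : Finset (Fin n)) (O : OG n) : TT P Q O ≤ n := by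
  refine le_trans ?_ (card_le_real P)
  calc TT P Q O ≤ ∑ _k ∈ P, (1 : ℝ) := Finset.sum_le_sum fun k _ => MM_diag_le Q O k
    _ = _ := by simp

lemma GG_nonneg {n : ℕ} (P Q : Finset (Fin n)) (O : OG n) : 0 ≤ GG P Q O := by
  unfold GG; positivity

lemma GG_le {n : ℕ} (P Q : Finset (Fin n)) (O : OG n) : GG P Q O ≤ n := by
  have h : 0 ≤ ∑ i ∈ P, ∑ k ∈ P, MM Q O i k ^ 2 := by positivity
  rw [GG_add] at h
  linarith [TT_le P Q O]

lemma VV_le {n : ℕ} (P Q : Finset (Fin n)) (O : OG n) : |VV P Q O| ≤ n * √n := by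
  have hN : ∀ i j, |∑ k ∈ P, MM Q O i k * MM Q O k j| ≤ 1 := by
    intro i j
    calc |∑ k ∈ P, MM Q O i k * MM Q O k j| ≤ ∑ k ∈ P, |MM Q O i k * MM Q O k j| :=
          Finset.abs_sum_le_sum_abs _ _
      _ ≤ ∑ k ∈ P, (MM Q O i k ^ 2 + MM Q O j k ^ 2) / 2 := by
          refine Finset.sum_le_sum fun k _ => ?_
          rw [MM_symm Q O k j, abs_le]
          constructor <;> nlinarith [sq_nonneg (MM Q O i k - MM Q O j k),
            sq_nonneg (MM Q O i k + MM Q O j k)]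
      _ ≤ ∑ k, (MM Q O i k ^ 2 + MM Q O j k ^ 2) / 2 :=
          Finset.sum_le_sum_of_subset_of_nonneg (Finset.subset_univ _)
            fun _ _ _ => by positivity
      _ = (MM Q O i i + MM Q O j j) / 2 := by
          rw [← Finset.sum_div, Finset.sum_add_distrib, MM_sq, MM_sq]
      _ ≤ 1 := by linarith [MM_diag_le Q O i, MM_diag_le Q O j]
  have hV : VV P Q O = ∑ x ∈ P ×ˢ Pᶜ, (∑ k ∈ P, MM Q O x.1 k * MM Q O k x.2) * MM Q O x.1 x.2 := by
    unfold VV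
    rw [Finset.sum_product]
    simp only [Finset.sum_mul]
  have hG : GG P Q O = ∑ x ∈ P ×ˢ Pᶜ, MM Q O x.1 x.2 ^ 2 := by
    unfold GG
    rw [Finset.sum_product]
  have cs := Finset.sum_mul_sq_le_sq_mul_sq (P ×ˢ Pᶜ)
    (fun x => ∑ k ∈ P, MM Q O x.1 k * MM Q O k x.2) (fun x => MM Q O x.1 x.2)
  rw [← hV, ← hG] at cs
  have h1 : ∑ x ∈ P ×ˢ Pᶜ, (∑ k ∈ P, MM Q O x.1 k * MM Q O k x.2) ^ 2 ≤ (n : ℝ) * n := by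
    calc _ ≤ ∑ _x ∈ P ×ˢ Pᶜ, (1 : ℝ) := Finset.sum_le_sum fun x _ => by
            rw [sq_le_one_iff_abs_le_one]; exact hN _ _
      _ = (P.card : ℝ) * Pᶜ.card := by simp
      _ ≤ n * n := mul_le_mul (card_le_real _) (card_le_real _) (by positivity) (by positivity)
  have hn : (0 : ℝ) ≤ n := by positivity
  have h2 : VV P Q O ^ 2 ≤ (n * √n) ^ 2 := by
    rw [mul_pow, Real.sq_sqrt hn]
    calc _ ≤ _ := cs
      _ ≤ (n : ℝ) * n * n := mul_le_mul h1 (GG_le P Q O) (GG_nonneg P Q O) (by positivity)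
      _ = _ := by ring
  exact abs_le_of_sq_le_sq h2 (by positivity)

end TruncCLT
namespace TruncCLT

lemma mean_T {n : ℕ} (hn : 0 < n) (P Q : Finset (Fin n))
    (μ : Measure (OG n)) [μ.IsHaarMeasure] [IsProbabilityMeasure μ] :
    ∫ O, TT P Q O ∂μ = P.card * Q.card / n := by
  have h := ident1 P Q μ (φ := fun _ => 1) (φ' := fun _ => 0)
    (fun x => hasDerivAt_const x _) continuous_const
  simp only [mul_one, mul_zero, add_zero] at h
  rw [integral_complex_ofReal, Complex.ofReal_eq_zero, integral_sub (integrable_const _)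
    ((integrable_cont μ (TT_cont P Q)).const_mul _), integral_const_mul (n : ℝ) (TT P Q)] at h
  simp only [integral_const, probReal_univ, one_smul] at h
  have : (n : ℝ) ≠ 0 := by positivity
  field_simp
  linarith

lemma var_T {n : ℕ} (hn : 0 < n) (P Q : Finset (Fin n))
    (μ : Measure (OG n)) [μ.IsHaarMeasure] [IsProbabilityMeasure μ] :
    ∫ O, (TT P Q O - P.card * Q.card / n) ^ 2 ∂μ ≤ 2 := by
  have hn0 : (0 : ℝ) < n := by positivity
  set τ : ℝ := P.card * Q.card / n with hτ
  have h := ident1 P Q μ (φ := fun x => ((x - τ : ℝ) : ℂ)) (φ' := fun _ => 1)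
    (fun x => by simpa using ((hasDerivAt_id x).sub_const τ).ofReal_comp) continuous_const
  have e : ∀ O, ((P.card * Q.card - n * TT P Q O : ℝ) : ℂ) * ((TT P Q O - τ : ℝ) : ℂ)
      + ((2 * GG P Q O : ℝ) : ℂ) * 1
      = ((2 * GG P Q O - n * (TT P Q O - τ) ^ 2 : ℝ) : ℂ) := by
    intro O
    have : (P.card * Q.card : ℝ) = n * τ := by rw [hτ]; field_simp
    rw [this]
    push_cast
    ring
  simp only [e] at h
  have i1 : Integrable (fun O => 2 * GG P Q O) μ :=
    integrable_cont μ (continuous_const.mul (GG_cont P Q))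
  have i2 : Integrable (fun O => (n : ℝ) * (TT P Q O - τ) ^ 2) μ :=
    integrable_cont μ (continuous_const.mul (((TT_cont P Q).sub continuous_const).pow 2))
  rw [integral_complex_ofReal, Complex.ofReal_eq_zero, integral_sub i1 i2, integral_const_mul _
    (fun O => (TT P Q O - τ) ^ 2)] at h
  have h3 : ∫ O, 2 * GG P Q O ∂μ ≤ ∫ _O, 2 * (n : ℝ) ∂μ :=
    integral_mono i1 (integrable_const _) fun O => by
      have := GG_le P Q O
      simp only
      linarith
  simp only [integral_const, probReal_univ, one_smul] at h3
  by_contra hc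
  push Not at hc
  nlinarith

lemma abs_T {n : ℕ} (hn : 0 < n) (P Q : Finset (Fin n))
    (μ : Measure (OG n)) [μ.IsHaarMeasure] [IsProbabilityMeasure μ] :
    ∫ O, |TT P Q O - P.card * Q.card / n| ∂μ ≤ 3 / 2 := by
  have h := var_T hn P Q μ
  set τ : ℝ := P.card * Q.card / n with hτ
  have cW : Continuous (fun O => TT P Q O - τ) := (TT_cont P Q).sub continuous_const
  have h2 : ∫ O, |TT P Q O - τ| ∂μ ≤ ∫ O, ((TT P Q O - τ) ^ 2 / 2 + 1 / 2) ∂μ := by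
    refine integral_mono (integrable_cont μ cW.abs)
      (integrable_cont μ (((cW.pow 2).div_const _).add continuous_const)) fun O => ?_
    simp only
    nlinarith [sq_nonneg (|TT P Q O - τ| - 1), sq_abs (TT P Q O - τ)]
  have ia : Integrable (fun O => (TT P Q O - τ) ^ 2 / 2) μ :=
    integrable_cont μ ((cW.pow 2).div_const _)
  rw [integral_add ia (integrable_const _), integral_div] at h2
  simp only [integral_const, probReal_univ, one_smul] at h2
  linarith

/-- The characteristic function of the centered trace. -/
noncomputable def psi {n : ℕ} (P Q : Finset (Fin n)) (μ : Measure (OG n)) (ξ : ℝ) : ℂ :=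
  ∫ O, Complex.exp ((ξ * (TT P Q O - P.card * Q.card / n) : ℝ) * Complex.I) ∂μ

/-- The variance at level `n`. -/
noncomputable def sig {n : ℕ} (P Q : Finset (Fin n)) : ℝ :=
  2 * ((P.card / n : ℝ) * (1 - P.card / n)) * ((Q.card / n : ℝ) * (1 - Q.card / n)) * (n / (n + 1))

lemma econt {n : ℕ} (P Q : Finset (Fin n)) (ξ τ : ℝ) :
    Continuous (fun O => Complex.exp ((ξ * (TT P Q O - τ) : ℝ) * Complex.I)) := by
  have := TT_cont P Q
  fun_prop

lemma psi_deriv {n : ℕ} (P Q : Finset (Fin n))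
    (μ : Measure (OG n)) [μ.IsHaarMeasure] [IsProbabilityMeasure μ] (ξ : ℝ) :
    HasDerivAt (psi P Q μ) (Complex.I * ∫ O, ((TT P Q O - P.card * Q.card / n : ℝ) : ℂ) *
      Complex.exp ((ξ * (TT P Q O - P.card * Q.card / n) : ℝ) * Complex.I) ∂μ) ξ := by
  set τ : ℝ := P.card * Q.card / n with hτ
  have cW : Continuous (fun O => TT P Q O - τ) := (TT_cont P Q).sub continuous_const
  obtain ⟨C, hC⟩ := isCompact_univ.exists_bound_of_continuousOn cW.continuousOn
  rw [← integral_const_mul]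
  have cF' : Continuous (fun O => Complex.I * (((TT P Q O - τ : ℝ) : ℂ) *
      Complex.exp ((ξ * (TT P Q O - τ) : ℝ) * Complex.I))) :=
    continuous_const.mul ((Complex.continuous_ofReal.comp cW).mul (econt P Q ξ τ))
  refine (hasDerivAt_integral_of_dominated_loc_of_deriv_le (μ := μ)
    (F := fun ξ O => Complex.exp ((ξ * (TT P Q O - τ) : ℝ) * Complex.I))
    (F' := fun ξ O => Complex.I * (((TT P Q O - τ : ℝ) : ℂ) *
      Complex.exp ((ξ * (TT P Q O - τ) : ℝ) * Complex.I))) (x₀ := ξ)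
    (s := Set.univ) (bound := fun _ => C) Filter.univ_mem
    (Eventually.of_forall fun θ => (econt P Q θ τ).aestronglyMeasurable)
    (integrable_cont μ (econt P Q ξ τ))
    cF'.aestronglyMeasurable
    (Eventually.of_forall fun O θ _ => ?_)
    (integrable_const _)
    (Eventually.of_forall fun O θ _ => ?_)).2
  · rw [norm_mul, norm_mul, Complex.norm_exp_ofReal_mul_I, Complex.norm_I, Complex.norm_real]
    simpa using hC O (Set.mem_univ _)
  · have h1 : HasDerivAt (fun θ : ℝ => θ * (TT P Q O - τ)) (TT P Q O - τ) θ := by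
      simpa using (hasDerivAt_id θ).mul_const (TT P Q O - τ)
    refine ((h1.ofReal_comp.mul_const Complex.I).cexp).congr_deriv ?_
    ring

lemma psi_ode {n : ℕ} (hn : 0 < n) (P Q : Finset (Fin n))
    (μ : Measure (OG n)) [μ.IsHaarMeasure] [IsProbabilityMeasure μ] (ξ : ℝ) :
    ‖(Complex.I * ∫ O, ((TT P Q O - P.card * Q.card / n : ℝ) : ℂ) *
      Complex.exp ((ξ * (TT P Q O - P.card * Q.card / n) : ℝ) * Complex.I) ∂μ)
      + ((sig P Q * ξ : ℝ) : ℂ) * psi P Q μ ξ‖ ≤ 2 * |ξ| * (5 + 2 * |ξ|) / √n := by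
  have hn0 : (0 : ℝ) < n := by positivity
  have hE := abs_T hn P Q μ
  have hpsi : psi P Q μ ξ =
    ∫ O, Complex.exp ((ξ * (TT P Q O - P.card * Q.card / n) : ℝ) * Complex.I) ∂μ := rfl
  have hsig : sig P Q = 2 * (((n : ℝ) - P.card) * (P.card * Q.card / n)
      - (P.card * Q.card / n) * (Q.card - P.card * Q.card / n)) / (n * (n + 1)) := by
    unfold sig
    field_simp
    try ring
  have hτn : (P.card * Q.card / n : ℝ) ≤ n := by
    rw [div_le_iff₀ hn0]
    exact mul_le_mul (card_le_real P) (card_le_real Q) (by positivity) (by positivity)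
  have hτ0 : (0 : ℝ) ≤ P.card * Q.card / n := by positivity
  have hpq : (P.card * Q.card : ℝ) = n * (P.card * Q.card / n) := by field_simp
  set τ : ℝ := P.card * Q.card / n with hτ
  set κ : ℝ := ((n : ℝ) - P.card) * τ - τ * (Q.card - τ) with hκ
  have cT := TT_cont P Q
  have cG := GG_cont P Q
  have cV := VV_cont P Q
  have cW : Continuous (fun O => TT P Q O - τ) := cT.sub continuous_const
  have ce := econt P Q ξ τ
  have hder : ∀ x : ℝ, HasDerivAt (fun x : ℝ => Complex.exp ((ξ * (x - τ) : ℝ) * Complex.I))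
      (ξ * Complex.I * Complex.exp ((ξ * (x - τ) : ℝ) * Complex.I)) x := by
    intro x
    have h1 : HasDerivAt (fun x : ℝ => ξ * (x - τ)) ξ x := by
      simpa using ((hasDerivAt_id x).sub_const τ).const_mul ξ
    refine ((h1.ofReal_comp.mul_const Complex.I).cexp).congr_deriv ?_
    ring
  have hdc : Continuous (fun x : ℝ => ξ * Complex.I *
      Complex.exp ((ξ * (x - τ) : ℝ) * Complex.I)) := by fun_prop
  have i1 := ident1 P Q μ hder hdc
  have i2 := ident2 P Q μ hder hdc
  rw [hpsi]
  set e : OG n → ℂ := fun O => Complex.exp ((ξ * (TT P Q O - τ) : ℝ) * Complex.I) with he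
  have hee : ∀ O, Complex.exp ((ξ * (TT P Q O - τ) : ℝ) * Complex.I) = e O := fun _ => rfl
  have hen : ∀ O, ‖e O‖ = 1 := fun O => Complex.norm_exp_ofReal_mul_I _
  simp only [hee] at i1 i2 ⊢
  have intg : ∀ {f : OG n → ℝ}, Continuous f → Integrable (fun O => (f O : ℂ) * e O) μ :=
    fun hf => integrable_cont μ ((Complex.continuous_ofReal.comp hf).mul ce)
  -- first identity
  have j1 : (n : ℂ) * ∫ O, ((TT P Q O - τ : ℝ) : ℂ) * e O ∂μ
      = 2 * ξ * Complex.I * ∫ O, (GG P Q O : ℂ) * e O ∂μ := by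
    have : ∀ O, ((P.card * Q.card - n * TT P Q O : ℝ) : ℂ) * e O
        + ((2 * GG P Q O : ℝ) : ℂ) * (ξ * Complex.I * e O)
        = 2 * ξ * Complex.I * ((GG P Q O : ℂ) * e O) - n * (((TT P Q O - τ : ℝ) : ℂ) * e O) := by
      intro O
      rw [hpq]
      push_cast
      ring
    simp only [this] at i1
    rw [integral_sub ((intg cG).const_mul _) ((intg cW).const_mul _), integral_const_mul,
      integral_const_mul] at i1
    exact (sub_eq_zero.1 i1).symm
  -- second identity
  have cD : Continuous (fun O => (TT P Q O - τ) * (n - P.card - Q.card + TT P Q O + τ)) :=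
    cW.mul ((continuous_const.add cT).add continuous_const)
  have j2 : ((n : ℂ) + 1) * ∫ O, (GG P Q O : ℂ) * e O ∂μ
      = κ * ∫ O, e O ∂μ
        + ∫ O, (((TT P Q O - τ) * (n - P.card - Q.card + TT P Q O + τ) : ℝ) : ℂ) * e O ∂μ
        - 2 * ξ * Complex.I * ∫ O, (VV P Q O : ℂ) * e O ∂μ := by
    have : ∀ O, (((n + 1) * GG P Q O - (n - P.card) * TT P Q O
          + TT P Q O * (Q.card - TT P Q O) : ℝ) : ℂ) * e O
        + ((2 * VV P Q O : ℝ) : ℂ) * (ξ * Complex.I * e O)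
        = ((n : ℂ) + 1) * ((GG P Q O : ℂ) * e O) - (κ * e O
          + (((TT P Q O - τ) * (n - P.card - Q.card + TT P Q O + τ) : ℝ) : ℂ) * e O
          - 2 * ξ * Complex.I * ((VV P Q O : ℂ) * e O)) := by
      intro O
      rw [hκ]
      push_cast
      ring
    simp only [this] at i2
    have ie : Integrable (fun O => (κ : ℂ) * e O) μ := (integrable_cont μ ce).const_mul _
    have iv : Integrable (fun O => 2 * ξ * Complex.I * ((VV P Q O : ℂ) * e O)) μ :=
      (intg cV).const_mul _
    have ia : Integrable (fun O => κ * e O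
      + (((TT P Q O - τ) * (n - P.card - Q.card + TT P Q O + τ) : ℝ) : ℂ) * e O) μ :=
      ie.add (intg cD)
    have ib : Integrable (fun O => κ * e O
      + (((TT P Q O - τ) * (n - P.card - Q.card + TT P Q O + τ) : ℝ) : ℂ) * e O
      - 2 * ξ * Complex.I * ((VV P Q O : ℂ) * e O)) μ := ia.sub iv
    rw [integral_sub ((intg cG).const_mul _) ib, integral_sub ia iv,
      integral_add ie (intg cD), integral_const_mul,
      integral_const_mul, integral_const_mul] at i2
    exact sub_eq_zero.1 i2
  have hD : ‖∫ O, (((TT P Q O - τ) * (n - P.card - Q.card + TT P Q O + τ) : ℝ) : ℂ) * e O ∂μ‖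
      ≤ 9 / 2 * n := by
    calc _ ≤ ∫ O, ‖(((TT P Q O - τ) * (n - P.card - Q.card + TT P Q O + τ) : ℝ) : ℂ) * e O‖ ∂μ :=
          norm_integral_le_integral_norm _
      _ ≤ ∫ O, |TT P Q O - τ| * (3 * n) ∂μ := by
          refine integral_mono (intg cD).norm
            (integrable_cont μ (cW.abs.mul continuous_const)) fun O => ?_
          simp only
          rw [norm_mul, hen, mul_one, Complex.norm_real, Real.norm_eq_abs, abs_mul]
          refine mul_le_mul_of_nonneg_left ?_ (abs_nonneg _)
          have h1 := TT_nonneg P Q O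
          have h2 := TT_le P Q O
          have h3 := card_le_real P
          have h4 := card_le_real Q
          have h5 : (0 : ℝ) ≤ P.card := Nat.cast_nonneg _
          have h6 : (0 : ℝ) ≤ Q.card := Nat.cast_nonneg _
          rw [abs_le]
          constructor <;> linarith
      _ = (∫ O, |TT P Q O - τ| ∂μ) * (3 * n) := integral_mul_const _ _
      _ ≤ 3 / 2 * (3 * n) := mul_le_mul_of_nonneg_right hE (by positivity)
      _ = _ := by ring
  have hV : ‖∫ O, (VV P Q O : ℂ) * e O ∂μ‖ ≤ n * √n := by
    have := norm_integral_le_of_norm_le_const (μ := μ) (f := fun O => (VV P Q O : ℂ) * e O)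
      (C := n * √n) (Eventually.of_forall fun O => by
        rw [norm_mul, hen, mul_one, Complex.norm_real]
        exact VV_le P Q O)
    simpa using this
  generalize (∫ O, ((TT P Q O - τ : ℝ) : ℂ) * e O ∂μ) = A at *
  generalize (∫ O, (GG P Q O : ℂ) * e O ∂μ) = B at *
  generalize (∫ O, (VV P Q O : ℂ) * e O ∂μ) = V at *
  generalize (∫ O, (((TT P Q O - τ) * (n - P.card - Q.card + TT P Q O + τ) : ℝ) : ℂ) * e O ∂μ)
    = D at *
  generalize (∫ O, e O ∂μ) = ψ at *
  have hnc : (n : ℂ) ≠ 0 := by exact_mod_cast hn0.ne'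
  have hnc1 : (n : ℂ) + 1 ≠ 0 := by exact_mod_cast (by positivity : (n : ℝ) + 1 ≠ 0)
  have hmain : Complex.I * A + ((sig P Q * ξ : ℝ) : ℂ) * ψ
      = ((-(2 * ξ) / (n * (n + 1)) : ℝ) : ℂ) * (D - 2 * ξ * Complex.I * V) := by
    have hA : Complex.I * A = -(2 * ξ * B) / n := by
      rw [eq_div_iff hnc]
      linear_combination Complex.I * j1 + 2 * ξ * B * Complex.I_sq
    have hB : B = (κ * ψ + D - 2 * ξ * Complex.I * V) / (n + 1) := by
      rw [eq_div_iff hnc1]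
      linear_combination j2
    rw [hA, hB, hsig]
    push_cast
    field_simp
    ring
  rw [hmain, norm_mul, Complex.norm_real, Real.norm_eq_abs, abs_div, abs_neg, abs_mul,
    abs_of_pos (by positivity : (0 : ℝ) < n * (n + 1)), abs_two]
  have hsq1 : 1 ≤ √(n : ℝ) := by
    rw [Real.one_le_sqrt]; exact_mod_cast hn
  have hnorm : ‖D - 2 * ξ * Complex.I * V‖ ≤ (5 + 2 * |ξ|) * (n * √n) := by
    calc _ ≤ ‖D‖ + ‖2 * ξ * Complex.I * V‖ := norm_sub_le _ _
      _ = ‖D‖ + 2 * |ξ| * ‖V‖ := by simp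
      _ ≤ 9 / 2 * n + 2 * |ξ| * (n * √n) :=
          add_le_add hD (mul_le_mul_of_nonneg_left hV (by positivity))
      _ ≤ _ := by nlinarith
  have hss : √(n : ℝ) * √n = n := Real.mul_self_sqrt hn0.le
  calc 2 * |ξ| / (n * (n + 1)) * ‖D - 2 * ξ * Complex.I * V‖
      ≤ 2 * |ξ| / (n * n) * ((5 + 2 * |ξ|) * (n * √n)) := by
        refine mul_le_mul ?_ hnorm (norm_nonneg _) (by positivity)
        gcongr
        linarith
    _ = 2 * |ξ| * (5 + 2 * |ξ|) / √n := by
        have : √(n : ℝ) ≠ 0 := by positivity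
        rw [div_mul_eq_mul_div, div_eq_div_iff (by positivity) this]
        linear_combination 2 * |ξ| * (5 + 2 * |ξ|) * n * hss

lemma psi_bound {n : ℕ} (hn : 0 < n) (P Q : Finset (Fin n))
    (μ : Measure (OG n)) [μ.IsHaarMeasure] [IsProbabilityMeasure μ] (ξ : ℝ) :
    ‖psi P Q μ ξ - Complex.exp (-((sig P Q * ξ ^ 2 / 2 : ℝ) : ℂ))‖
      ≤ (Real.exp (ξ ^ 2) * (2 * |ξ| * (5 + 2 * |ξ|)) * |ξ|) / √n := by
  have hn0 : (0 : ℝ) < n := by positivity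
  have hb : ∀ R : Finset (Fin n), 0 ≤ (R.card / n : ℝ) * (1 - R.card / n) ∧
      (R.card / n : ℝ) * (1 - R.card / n) ≤ 1 := by
    intro R
    have h1 : (0 : ℝ) ≤ R.card / n := by positivity
    have h2 : (R.card / n : ℝ) ≤ 1 := (div_le_one hn0).2 (card_le_real R)
    constructor <;> nlinarith
  have hf0 : (0 : ℝ) ≤ n / (n + 1) := by positivity
  have hf1 : (n / (n + 1) : ℝ) ≤ 1 := (div_le_one (by positivity)).2 (by linarith)
  have s0 : 0 ≤ sig P Q :=
    mul_nonneg (mul_nonneg (mul_nonneg zero_le_two (hb P).1) (hb Q).1) hf0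
  have s2 : sig P Q ≤ 2 := by
    unfold sig
    have := mul_le_one₀ (hb P).2 (hb Q).1 (hb Q).2
    have := mul_le_one₀ this hf0 hf1
    nlinarith
  set v := sig P Q with hv
  have hg : ∀ u : ℝ, HasDerivAt (fun u : ℝ => Complex.exp ((v * u ^ 2 / 2 : ℝ) : ℂ))
      (((v * u : ℝ) : ℂ) * Complex.exp ((v * u ^ 2 / 2 : ℝ) : ℂ)) u := by
    intro u
    have h1 : HasDerivAt (fun u : ℝ => v * u ^ 2 / 2) (v * u) u := by
      refine (((hasDerivAt_pow 2 u).const_mul v).div_const 2).congr_deriv ?_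
      norm_num
      ring
    refine (h1.ofReal_comp.cexp).congr_deriv ?_
    ring
  set A : ℝ → ℂ := fun u => Complex.I * ∫ O, ((TT P Q O - P.card * Q.card / n : ℝ) : ℂ) *
      Complex.exp ((u * (TT P Q O - P.card * Q.card / n) : ℝ) * Complex.I) ∂μ with hA
  have hh : ∀ u : ℝ, HasDerivAt (fun u => psi P Q μ u * Complex.exp ((v * u ^ 2 / 2 : ℝ) : ℂ))
      ((A u + ((v * u : ℝ) : ℂ) * psi P Q μ u) * Complex.exp ((v * u ^ 2 / 2 : ℝ) : ℂ)) u := by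
    intro u
    refine ((psi_deriv P Q μ u).fun_mul (hg u)).congr_deriv ?_
    simp only [hA]
    ring
  have hmv := Convex.norm_image_sub_le_of_norm_hasDerivWithin_le
    (f := fun u => psi P Q μ u * Complex.exp ((v * u ^ 2 / 2 : ℝ) : ℂ))
    (s := Set.Icc (-|ξ|) |ξ|) (x := 0) (y := ξ)
    (C := Real.exp (ξ ^ 2) * (2 * |ξ| * (5 + 2 * |ξ|)) / √n)
    (fun u _ => (hh u).hasDerivWithinAt) (fun u hu => by
      have hu' : |u| ≤ |ξ| := abs_le.2 hu
      have hu2 : u ^ 2 ≤ ξ ^ 2 := sq_le_sq.2 hu'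
      rw [norm_mul, ← Complex.ofReal_exp, Complex.norm_real, Real.norm_eq_abs, Real.abs_exp]
      calc _ ≤ (2 * |u| * (5 + 2 * |u|) / √n) * Real.exp (v * u ^ 2 / 2) :=
            mul_le_mul_of_nonneg_right (psi_ode hn P Q μ u) (Real.exp_pos _).le
        _ ≤ (2 * |ξ| * (5 + 2 * |ξ|) / √n) * Real.exp (ξ ^ 2) := by
            gcongr
            nlinarith [sq_nonneg u]
        _ = _ := by ring)
    (convex_Icc _ _) (by simp) (abs_le.1 le_rfl)
  have h0 : psi P Q μ 0 = 1 := by simp [psi]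
  rw [h0] at hmv
  have hfac : psi P Q μ ξ - Complex.exp (-((v * ξ ^ 2 / 2 : ℝ) : ℂ))
      = (psi P Q μ ξ * Complex.exp ((v * ξ ^ 2 / 2 : ℝ) : ℂ) - 1)
        * Complex.exp (-((v * ξ ^ 2 / 2 : ℝ) : ℂ)) := by
    rw [sub_mul, mul_assoc, ← Complex.exp_add]
    simp
  have hne : ‖Complex.exp (-((v * ξ ^ 2 / 2 : ℝ) : ℂ))‖ = Real.exp (-(v * ξ ^ 2 / 2)) := by
    rw [Complex.norm_exp, Complex.neg_re, Complex.ofReal_re]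
  rw [hfac, norm_mul, hne]
  have hle : Real.exp (-(v * ξ ^ 2 / 2)) ≤ 1 := Real.exp_le_one_iff.2 (by
    have : 0 ≤ v * ξ ^ 2 / 2 := by positivity
    linarith)
  calc _ ≤ ‖psi P Q μ ξ * Complex.exp ((v * ξ ^ 2 / 2 : ℝ) : ℂ) - 1‖ * 1 :=
        mul_le_mul_of_nonneg_left hle (norm_nonneg _)
    _ ≤ _ := by
        rw [mul_one]
        have h00 : Complex.exp ((v * 0 ^ 2 / 2 : ℝ) : ℂ) = 1 := by simp
        rw [h00, mul_one, sub_zero, Real.norm_eq_abs] at hmv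
        refine le_trans hmv (le_of_eq ?_)
        ring

lemma trunc_eq {n : ℕ} (p q : ℕ) (O : OG n) :
    truncTraceO n p q O = TT (Finset.univ.filter fun i : Fin n => (i : ℕ) < p)
      (Finset.univ.filter fun i : Fin n => (i : ℕ) < q) O := by
  unfold truncTraceO TT MM
  rw [Finset.sum_filter]
  refine Finset.sum_congr rfl fun i _ => ?_
  rw [Finset.sum_filter]
  by_cases h : (i : ℕ) < p
  · simp [h, sq]
  · simp [h]

lemma card_filt {n p : ℕ} (hp : p ≤ n) :
    (Finset.univ.filter fun i : Fin n => (i : ℕ) < p).card = p := by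
  rw [Fin.card_filter_val_lt]
  exact min_eq_right hp

lemma floor_le {s : ℝ} (hs : s ≤ 1) (n : ℕ) : ⌊(n : ℝ) * s⌋₊ ≤ n := by
  apply Nat.floor_le_of_le
  have : (0 : ℝ) ≤ n := by positivity
  nlinarith

lemma floor_lim {s : ℝ} (hs : 0 ≤ s) :
    Tendsto (fun n : ℕ => ((⌊(n : ℝ) * s⌋₊ : ℕ) : ℝ) / n) atTop (nhds s) := by
  have h := (tendsto_nat_floor_mul_div_atTop hs).comp (tendsto_natCast_atTop_atTop (R := ℝ))
  refine h.congr fun n => ?_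
  simp [mul_comm]

end TruncCLT

open TruncCLT

/-- If `O⁽ⁿ⁾` is Haar distributed on `O(n)` and `s, t ∈ [0,1]`, then
`T_{⌊ns⌋,⌊nt⌋} - E[T_{⌊ns⌋,⌊nt⌋}]` converges in distribution to a centered Gaussian with
variance `2s(1-s)t(1-t)` (weak convergence tested against bounded continuous functions). -/
theorem truncTraceO_marginal_clt
    (μ : ∀ n : ℕ, Measure (Matrix.orthogonalGroup (Fin n) ℝ))
    (hHaar : ∀ n, (μ n).IsHaarMeasure) (hProb : ∀ n, IsProbabilityMeasure (μ n))
    (s t : ℝ) (hs : s ∈ Set.Icc (0 : ℝ) 1) (ht : t ∈ Set.Icc (0 : ℝ) 1) :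
    ∀ f : BoundedContinuousFunction ℝ ℝ,
      Tendsto (fun n : ℕ =>
          ∫ O, f (truncTraceO n ⌊(n : ℝ) * s⌋₊ ⌊(n : ℝ) * t⌋₊ O -
            ∫ P, truncTraceO n ⌊(n : ℝ) * s⌋₊ ⌊(n : ℝ) * t⌋₊ P ∂(μ n)) ∂(μ n))
        atTop
        (nhds (∫ x, f x ∂(gaussianReal 0
          (Real.toNNReal (2 * (s * (1 - s)) * (t * (1 - t))))))) := by
  obtain ⟨hs0, hs1⟩ := hs
  obtain ⟨ht0, ht1⟩ := ht
  simp only [trunc_eq]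
  set PP : ∀ n : ℕ, Finset (Fin n) := fun n =>
    Finset.univ.filter fun i : Fin n => (i : ℕ) < ⌊(n : ℝ) * s⌋₊ with hPP
  set QQ : ∀ n : ℕ, Finset (Fin n) := fun n =>
    Finset.univ.filter fun i : Fin n => (i : ℕ) < ⌊(n : ℝ) * t⌋₊ with hQQ
  have hPc : ∀ n, (PP n).card = ⌊(n : ℝ) * s⌋₊ := fun n => card_filt (floor_le hs1 n)
  have hQc : ∀ n, (QQ n).card = ⌊(n : ℝ) * t⌋₊ := fun n => card_filt (floor_le ht1 n)
  set W : ∀ n : ℕ, OG n → ℝ := fun n O =>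
    TT (PP n) (QQ n) O - ∫ P, TT (PP n) (QQ n) P ∂(μ n) with hW
  have hWc : ∀ n, Continuous (W n) := fun n => (TT_cont _ _).sub continuous_const
  have hWm : ∀ n, AEMeasurable (W n) (μ n) := fun n => (hWc n).measurable.aemeasurable
  have hpm : ∀ n, IsProbabilityMeasure ((μ n).map (W n)) := fun n =>
    Measure.isProbabilityMeasure_map (hWm n)
  set vv : NNReal := Real.toNNReal (2 * (s * (1 - s)) * (t * (1 - t))) with hvv
  have hv0 : 0 ≤ 2 * (s * (1 - s)) * (t * (1 - t)) :=
    mul_nonneg (mul_nonneg zero_le_two (mul_nonneg hs0 (by linarith)))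
      (mul_nonneg ht0 (by linarith))
  have hvr : (vv : ℝ) = 2 * (s * (1 - s)) * (t * (1 - t)) := Real.coe_toNNReal _ hv0
  have hsig : Tendsto (fun n : ℕ => sig (PP n) (QQ n)) atTop (nhds (vv : ℝ)) := by
    have h1 := floor_lim hs0
    have h2 := floor_lim ht0
    have h3 : Tendsto (fun n : ℕ => (n : ℝ) / (n + 1)) atTop (nhds 1) :=
      tendsto_natCast_div_add_atTop 1
    have h4 := (((tendsto_const_nhds (x := (2 : ℝ))).mul
      (h1.mul ((tendsto_const_nhds (x := (1 : ℝ))).sub h1))).mul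
      (h2.mul ((tendsto_const_nhds (x := (1 : ℝ))).sub h2))).mul h3
    rw [hvr]
    rw [mul_one] at h4
    refine h4.congr fun n => ?_
    unfold sig
    rw [hPc, hQc]
  obtain ⟨nu, hnu⟩ : ∃ nu : ℕ → ProbabilityMeasure ℝ, ∀ n, (nu n : Measure ℝ) = (μ n).map (W n) :=
    ⟨fun n => ⟨(μ n).map (W n), hpm n⟩, fun _ => rfl⟩
  obtain ⟨g, hg⟩ : ∃ g : ProbabilityMeasure ℝ, (g : Measure ℝ) = gaussianReal 0 vv :=
    ⟨⟨gaussianReal 0 vv, inferInstance⟩, rfl⟩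
  have hlim : Tendsto nu atTop (nhds g) := by
    rw [ProbabilityMeasure.tendsto_iff_tendsto_charFun]
    intro ξ
    simp only [hnu, hg]
    rw [charFun_gaussianReal]
    have hchar : ∀ n, 0 < n → charFun ((μ n).map (W n)) ξ = psi (PP n) (QQ n) (μ n) ξ := by
      intro n hn
      rw [charFun_apply_real, integral_map (hWm n) (by fun_prop)]
      unfold psi
      simp only [hW, mean_T hn]
      push_cast
      rfl
    have hE : Tendsto (fun n : ℕ => Complex.exp (-((sig (PP n) (QQ n) * ξ ^ 2 / 2 : ℝ) : ℂ))) atTop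
        (nhds (Complex.exp (ξ * (0 : ℝ) * Complex.I - (vv : ℝ) * ξ ^ 2 / 2))) := by
      have : Complex.exp (ξ * (0 : ℝ) * Complex.I - (vv : ℝ) * ξ ^ 2 / 2)
          = Complex.exp (-(((vv : ℝ) * ξ ^ 2 / 2 : ℝ) : ℂ)) := by
        congr 1
        push_cast
        ring
      rw [this]
      have hc : Continuous (fun x : ℝ => Complex.exp (-((x * ξ ^ 2 / 2 : ℝ) : ℂ))) := by fun_prop
      exact (hc.tendsto (vv : ℝ)).comp hsig
    have hdiff : Tendsto (fun n : ℕ => charFun ((μ n).map (W n)) ξ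
        - Complex.exp (-((sig (PP n) (QQ n) * ξ ^ 2 / 2 : ℝ) : ℂ))) atTop (nhds 0) := by
      refine squeeze_zero_norm' (a := fun n : ℕ =>
        (Real.exp (ξ ^ 2) * (2 * |ξ| * (5 + 2 * |ξ|)) * |ξ|) / √n) ?_ ?_
      · filter_upwards [eventually_gt_atTop 0] with n hn
        rw [hchar n hn]
        exact psi_bound hn _ _ (μ n) ξ
      · exact tendsto_const_nhds.div_atTop
          (Real.tendsto_sqrt_atTop.comp tendsto_natCast_atTop_atTop)
    have := hdiff.add hE
    simpa using this
  intro f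
  have h := ProbabilityMeasure.tendsto_iff_forall_integral_tendsto.1 hlim f
  simp only [hnu, hg] at h
  refine h.congr fun n => ?_
  rw [integral_map (hWm n) f.continuous.aestronglyMeasurable]
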